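/- arXiv:1910.06132 — 7 statements merged into one kernel-verified Lean document; each statement's English description precedes it below -/
import Mathlib

section
/- Let δ be an S¹-structure on a 𝕜-module C compatible with a direct sum decomposition C = C₀ ⊕ C₊. Then: (i) the sequence (δ⁰₊, δ¹₊, δ²₊, …) is an S¹-structure on C₊; (ii) the sequence (δ⁰₀, 0, 0, …) is an S¹-structure on C₀; and (iii) the sequence (δ⁰₊,₀, δ¹₊,₀, δ²₊,₀, …) is an S¹-morphism from (C₊, (δⁱ₊)) to (C₀, (−δ⁰₀, 0, 0, …)). -/
/-!
STATEMENT 3: Let δ be an S¹-structure on a 𝕜-module C compatible with a direct sum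
decomposition C = C₀ ⊕ C₊.  Then: (i) the sequence (δ⁰₊, δ¹₊, δ²₊, …) is an
S¹-structure on C₊; (ii) the sequence (δ⁰₀, 0, 0, …) is an S¹-structure on C₀; and
(iii) the sequence (δ⁰₊,₀, δ¹₊,₀, δ²₊,₀, …) is an S¹-morphism from (C₊, (δⁱ₊)) to
(C₀, (−δ⁰₀, 0, 0, …)).

The splitting `C = C₀ ⊕ C₊` is modelled by `C = C0 × Cp`.
-/

open Finset

variable {𝕜 : Type*} [Field 𝕜]

/-- `δ` is an `S¹`-structure: `∑_{i+j=m} δⁱ ∘ δʲ = 0` for all `m ≥ 0`. -/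
def IsS1Structure {C : Type*} [AddCommGroup C] [Module 𝕜 C]
    (δ : ℕ → C →ₗ[𝕜] C) : Prop :=
  ∀ m : ℕ, ∀ c : C, ∑ i ∈ Finset.range (m + 1), δ i (δ (m - i) c) = 0

/-- `φ` is an `S¹`-morphism from `(C, δ)` to `(D, d)`:
`∑_{i+j=m} (φⁱ ∘ δʲ − dʲ ∘ φⁱ) = 0` for all `m ≥ 0`. -/
def IsS1Morphism {C D : Type*} [AddCommGroup C] [Module 𝕜 C]
    [AddCommGroup D] [Module 𝕜 D]
    (δ : ℕ → C →ₗ[𝕜] C) (d : ℕ → D →ₗ[𝕜] D) (φ : ℕ → C →ₗ[𝕜] D) : Prop :=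
  ∀ m : ℕ, ∀ c : C,
    ∑ i ∈ Finset.range (m + 1), (φ i (δ (m - i) c) - d (m - i) (φ i c)) = 0

variable {C0 Cp : Type*} [AddCommGroup C0] [Module 𝕜 C0]
  [AddCommGroup Cp] [Module 𝕜 Cp]

/-- The component `δʳ₀ : C₀ → C₀` of `δʳ`. -/
def deltaZero (δ : ℕ → (C0 × Cp) →ₗ[𝕜] C0 × Cp) : ℕ → C0 →ₗ[𝕜] C0 :=
  fun r => LinearMap.fst 𝕜 C0 Cp ∘ₗ δ r ∘ₗ LinearMap.inl 𝕜 C0 Cp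

/-- The component `δʳ₊ : C₊ → C₊` of `δʳ`. -/
def deltaPlus (δ : ℕ → (C0 × Cp) →ₗ[𝕜] C0 × Cp) : ℕ → Cp →ₗ[𝕜] Cp :=
  fun r => LinearMap.snd 𝕜 C0 Cp ∘ₗ δ r ∘ₗ LinearMap.inr 𝕜 C0 Cp

/-- The component `δʳ₊,₀ : C₊ → C₀` of `δʳ`. -/
def deltaPlusZero (δ : ℕ → (C0 × Cp) →ₗ[𝕜] C0 × Cp) : ℕ → Cp →ₗ[𝕜] C0 :=
  fun r => LinearMap.fst 𝕜 C0 Cp ∘ₗ δ r ∘ₗ LinearMap.inr 𝕜 C0 Cp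

theorem stmt_3 (δ : ℕ → (C0 × Cp) →ₗ[𝕜] C0 × Cp) (hδ : IsS1Structure δ)
    -- compatibility with the splitting: `δ⁰(C₀) ⊆ C₀` and `δⁱ|_{C₀} = 0` for `i ≥ 1`
    (hcomp0 : ∀ c : C0, (δ 0 (c, 0)).2 = 0)
    (hcomp : ∀ i, 1 ≤ i → ∀ c : C0, δ i (c, 0) = 0) :
    -- (i) `(δ⁰₊, δ¹₊, δ²₊, …)` is an `S¹`-structure on `C₊`
    IsS1Structure (deltaPlus δ) ∧
    -- (ii) `(δ⁰₀, 0, 0, …)` is an `S¹`-structure on `C₀`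
    IsS1Structure (fun i => if i = 0 then deltaZero δ 0 else 0) ∧
    -- (iii) `(δⁱ₊,₀)` is an `S¹`-morphism from `(C₊, (δⁱ₊))` to `(C₀, (−δ⁰₀, 0, …))`
    IsS1Morphism (deltaPlus δ) (fun i => if i = 0 then -(deltaZero δ 0) else 0)
      (deltaPlusZero δ) := by
  have split (i : ℕ) (x : C0 × Cp) : δ i x = δ i (x.1, 0) + δ i (0, x.2) := by
    rw [← map_add]; simp
  have snd_zero (i : ℕ) (c : C0) : (δ i (c, 0)).2 = 0 := by
    rcases Nat.eq_zero_or_pos i with rfl | hi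
    · exact hcomp0 c
    · rw [hcomp i hi c, Prod.snd_zero]
  refine ⟨fun m c => ?_, fun m c => ?_, fun m c => ?_⟩
  · have h := congrArg Prod.snd (hδ m (0, c))
    rw [Prod.snd_sum, Prod.snd_zero] at h
    rw [← h]
    refine Finset.sum_congr rfl fun i _ => ?_
    rw [split i (δ (m - i) (0, c)), Prod.snd_add, snd_zero, zero_add]
    rfl
  · refine Finset.sum_eq_zero fun i hi => ?_
    by_cases h0 : i = 0
    · subst h0
      by_cases hm : m = 0
      · subst hm
        have h := congrArg Prod.fst (hδ 0 (c, 0))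
        have hc : ((δ 0 (c, 0)).1, 0) = δ 0 (c, 0) := Prod.ext rfl (hcomp0 c).symm
        simpa [deltaZero, hc] using h
      · simp [hm]
    · simp [h0]
  · have h := congrArg Prod.fst (hδ m (0, c))
    rw [Prod.fst_sum, Prod.fst_zero] at h
    have hsum : ∑ i ∈ Finset.range (m + 1), (δ i (δ (m - i) (0, c))).1 =
        (δ 0 ((δ m (0, c)).1, 0)).1 +
          ∑ i ∈ Finset.range (m + 1), (δ i (0, (δ (m - i) (0, c)).2)).1 := by
      simp_rw [fun i => split i (δ (m - i) (0, c)), Prod.fst_add, Finset.sum_add_distrib]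
      congr 1
      rw [Finset.sum_eq_single 0]
      · rfl
      · intro i _ hi
        rw [hcomp i (Nat.one_le_iff_ne_zero.mpr hi), Prod.fst_zero]
      · simp
    rw [hsum] at h
    rw [Finset.sum_sub_distrib, Finset.sum_eq_single (f := fun i =>
      (if m - i = 0 then -(deltaZero δ 0) else 0) (deltaPlusZero δ i c)) m]
    · rw [← h]
      simp [deltaZero, deltaPlus, deltaPlusZero, add_comm]
    · intro i hi hne
      have : m - i ≠ 0 := by
        have := Finset.mem_range.mp hi
        omega
      simp [this]
    · simp
end

section
/- Let φ : (C, δ) → (D, ∂) be an S¹-morphism. Then φ⁰(Z_k(C)) ⊆ Z_k(D) and φ⁰(B_k(C)) ⊆ B_k(D) for every k ≥ 0, and for every k ≥ 1 the maps induced by φ⁰ satisfy φ⁰ ∘ Δᵏ_C = Δᵏ_D ∘ φ⁰ as maps Z_{k−1}(C)/B₀(C) → Z₀(D)/B_{k−1}(D); concretely, for every α₀ ∈ Z_{k−1}(C) with witness family (α₁, …, α_{k−1}) there is a witness family (β₁, …, β_{k−1}) for φ⁰(α₀) ∈ Z_{k−1}(D) with ∑_{i=1}^{k} ∂ⁱ(β_{k−i})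 − φ⁰(∑_{i=1}^{k} δⁱ(α_{k−i})) ∈ B_{k−1}(D). Moreover, if φ̃ is an S¹-morphism that is S¹-homotopic to φ, then φ⁰(α₀) − φ̃⁰(α₀) ∈ B₀(D) for every α₀ ∈ Z₀(C), so φ and φ̃ induce the same commutative diagrams with Δᵏ. -/
/-!
STATEMENT 8: Let φ : (C, δ) → (D, ∂) be an S¹-morphism.  Then φ⁰(Z_k(C)) ⊆ Z_k(D) and
φ⁰(B_k(C)) ⊆ B_k(D) for every k ≥ 0, and for every k ≥ 1 the maps induced by φ⁰
satisfy φ⁰ ∘ Δᵏ_C = Δᵏ_D ∘ φ⁰ as maps Z_{k−1}(C)/B₀(C) → Z₀(D)/B_{k−1}(D); concretely,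
for every α₀ ∈ Z_{k−1}(C) with witness family (α₁, …, α_{k−1}) there is a witness
family (β₁, …, β_{k−1}) for φ⁰(α₀) ∈ Z_{k−1}(D) with
∑_{i=1}^{k} ∂ⁱ(β_{k−i}) − φ⁰(∑_{i=1}^{k} δⁱ(α_{k−i})) ∈ B_{k−1}(D).  Moreover, if φ̃
is an S¹-morphism that is S¹-homotopic to φ, then φ⁰(α₀) − φ̃⁰(α₀) ∈ B₀(D) for every
α₀ ∈ Z₀(C), so φ and φ̃ induce the same commutative diagrams with Δᵏ.
-/

open Finset

variable {𝕜 : Type*} [Field 𝕜]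

/-- `h` is an `S¹`-homotopy between `S¹`-morphisms `φ` and `φ'`:
`φᵐ − φ'ᵐ = ∑_{i+j=m} (hⁱ ∘ δʲ + dʲ ∘ hⁱ)` for all `m ≥ 0`. -/
def IsS1Homotopy {C D : Type*} [AddCommGroup C] [Module 𝕜 C]
    [AddCommGroup D] [Module 𝕜 D]
    (δ : ℕ → C →ₗ[𝕜] C) (d : ℕ → D →ₗ[𝕜] D)
    (φ φ' : ℕ → C →ₗ[𝕜] D) (h : ℕ → C →ₗ[𝕜] D) : Prop :=
  ∀ m : ℕ, ∀ c : C, φ m c - φ' m c =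
    ∑ i ∈ Finset.range (m + 1), (h i (δ (m - i) c) + d (m - i) (h i c))

/-- `Z_k`: elements `α₀` admitting a witness family `α₁, …, α_k` with
`∑_{i=0}^{m} δⁱ(α_{m−i}) = 0` for every `0 ≤ m ≤ k`. -/
def ZSet {C : Type*} [AddCommGroup C] [Module 𝕜 C]
    (δ : ℕ → C →ₗ[𝕜] C) (k : ℕ) : Set C :=
  {a | ∃ α : ℕ → C, α 0 = a ∧
    ∀ m, m ≤ k → ∑ i ∈ Finset.range (m + 1), δ i (α (m - i)) = 0}

/-- `B_k`: elements `α` for which there exist `α₀, …, α_k` with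
`α = ∑_{i=0}^{k} δⁱ(α_{k−i})` and `∑_{i=0}^{k−j} δⁱ(α_{k−j−i}) = 0` for `1 ≤ j ≤ k`. -/
def BSet {C : Type*} [AddCommGroup C] [Module 𝕜 C]
    (δ : ℕ → C →ₗ[𝕜] C) (k : ℕ) : Set C :=
  {b | ∃ α : ℕ → C, b = ∑ i ∈ Finset.range (k + 1), δ i (α (k - i)) ∧
    ∀ j, 1 ≤ j → j ≤ k → ∑ i ∈ Finset.range (k - j + 1), δ i (α (k - j - i)) = 0}

lemma sum_antidiagonal_assoc {M : Type*} [AddCommMonoid M] (f : ℕ → ℕ → ℕ → M) (n : ℕ) :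
    ∑ p ∈ antidiagonal n, ∑ q ∈ antidiagonal p.2, f p.1 q.1 q.2 =
      ∑ p ∈ antidiagonal n, ∑ q ∈ antidiagonal p.1, f q.1 q.2 p.2 := by
  rw [sum_sigma', sum_sigma']
  refine sum_nbij' (fun x => ⟨(x.1.1 + x.2.1, x.2.2), (x.1.1, x.2.1)⟩)
    (fun x => ⟨(x.2.1, x.2.2 + x.1.2), (x.2.2, x.1.2)⟩) ?_ ?_ ?_ ?_ ?_ <;>
  · rintro ⟨⟨a, b⟩, ⟨c, e⟩⟩
    simp only [mem_sigma, HasAntidiagonal.mem_antidiagonal]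
    rintro ⟨rfl, rfl⟩
    simp [add_assoc]

/-- The convolution `m ↦ ∑_{i+j=m} fⁱ(αⱼ)` of a sequence of maps with a sequence of elements. -/
def convApply {C D : Type*} [AddCommGroup C] [Module 𝕜 C] [AddCommGroup D] [Module 𝕜 D]
    (f : ℕ → C →ₗ[𝕜] D) (α : ℕ → C) (m : ℕ) : D :=
  ∑ i ∈ Finset.range (m + 1), f i (α (m - i))

section

variable {C D : Type*} [AddCommGroup C] [Module 𝕜 C] [AddCommGroup D] [Module 𝕜 D]

lemma convApply_eq_sum_antidiagonal (f : ℕ → C →ₗ[𝕜] D) (α : ℕ → C) (m : ℕ) :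
    convApply f α m = ∑ p ∈ antidiagonal m, f p.1 (α p.2) :=
  (Finset.Nat.sum_antidiagonal_eq_sum_range_succ (fun i j => f i (α j)) m).symm

lemma convApply_zero (f : ℕ → C →ₗ[𝕜] D) (α : ℕ → C) : convApply f α 0 = f 0 (α 0) := by
  simp [convApply]

lemma convApply_eq_add_sum_Icc (f : ℕ → C →ₗ[𝕜] D) (α : ℕ → C) (m : ℕ) :
    convApply f α m = f 0 (α m) + ∑ i ∈ Finset.Icc 1 m, f i (α (m - i)) := by
  rw [convApply, Finset.range_eq_Ico, Finset.sum_eq_sum_Ico_succ_bot m.succ_pos]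
  rfl

lemma convApply_eq_apply_zero (f : ℕ → C →ₗ[𝕜] D) {α : ℕ → C} {k : ℕ}
    (hα : ∀ m < k, α m = 0) : convApply f α k = f 0 (α k) := by
  rw [convApply_eq_add_sum_Icc, Finset.sum_eq_zero, add_zero]
  intro i hi
  rw [Finset.mem_Icc] at hi
  rw [hα _ (by omega), map_zero]

lemma convApply_eq_zero (f : ℕ → C →ₗ[𝕜] D) {α : ℕ → C} {k : ℕ}
    (hα : ∀ m ≤ k, α m = 0) : convApply f α k = 0 := by
  rw [convApply_eq_apply_zero f fun m hm => hα m hm.le, hα k le_rfl, map_zero]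

/-- A morphism intertwines the total differentials. -/
lemma IsS1Morphism.convApply_comm {δ : ℕ → C →ₗ[𝕜] C} {d : ℕ → D →ₗ[𝕜] D}
    {φ : ℕ → C →ₗ[𝕜] D} (hφ : IsS1Morphism δ d φ) (α : ℕ → C) :
    convApply d (convApply φ α) = convApply φ (convApply δ α) := by
  have key (m : ℕ) (c : C) : ∑ p ∈ antidiagonal m, d p.1 (φ p.2 c) =
      ∑ p ∈ antidiagonal m, φ p.1 (δ p.2 c) := by
    have := hφ m c
    rw [← Finset.Nat.sum_antidiagonal_eq_sum_range_succ
      (fun i j => φ i (δ j c) - d j (φ i c)) m, sum_sub_distrib, sub_eq_zero] at this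
    rw [this, ← Finset.Nat.sum_antidiagonal_swap]
    rfl
  funext m
  simp only [convApply_eq_sum_antidiagonal, map_sum]
  rw [sum_antidiagonal_assoc (fun i j l => d i (φ j (α l))),
    sum_antidiagonal_assoc (fun i j l => φ i (δ j (α l)))]
  exact sum_congr rfl fun p _ => key p.1 (α p.2)

lemma mem_BSet_iff {δ : ℕ → C →ₗ[𝕜] C} {k : ℕ} {b : C} :
    b ∈ BSet δ k ↔ ∃ α : ℕ → C, b = convApply δ α k ∧ ∀ m < k, convApply δ α m = 0 := by
  refine exists_congr fun α => and_congr_right fun _ => ⟨fun H m hm => ?_, fun H j h₁ h₂ => ?_⟩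
  · have := H (k - m) (by omega) (by omega)
    rwa [Nat.sub_sub_self hm.le] at this
  · exact H (k - j) (by omega)

lemma apply_zero_mem_BSet (δ : ℕ → C →ₗ[𝕜] C) (k : ℕ) (x : C) : δ 0 x ∈ BSet δ k := by
  refine mem_BSet_iff.2 ⟨Pi.single k x, ?_, fun m hm => ?_⟩
  · rw [convApply_eq_apply_zero δ fun m hm => Pi.single_eq_of_ne hm.ne _, Pi.single_eq_same]
  · exact convApply_eq_zero δ fun l hl => Pi.single_eq_of_ne (hl.trans_lt hm).ne _

end

theorem stmt_8 {C D : Type*} [AddCommGroup C] [Module 𝕜 C]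
    [AddCommGroup D] [Module 𝕜 D]
    (δ : ℕ → C →ₗ[𝕜] C) (d : ℕ → D →ₗ[𝕜] D)
    (hδ : IsS1Structure δ) (hd : IsS1Structure d)
    (φ φ' : ℕ → C →ₗ[𝕜] D)
    (hφ : IsS1Morphism δ d φ) (hφ' : IsS1Morphism δ d φ')
    (h : ℕ → C →ₗ[𝕜] D) (hh : IsS1Homotopy δ d φ φ' h) :
    -- `φ⁰` maps `Z_k(C)` into `Z_k(D)`
    (∀ k : ℕ, ∀ a ∈ ZSet δ k, φ 0 a ∈ ZSet d k) ∧
    -- `φ⁰` maps `B_k(C)` into `B_k(D)`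
    (∀ k : ℕ, ∀ b ∈ BSet δ k, φ 0 b ∈ BSet d k) ∧
    -- `φ⁰ ∘ Δᵏ_C = Δᵏ_D ∘ φ⁰`
    (∀ k : ℕ, 1 ≤ k → ∀ α : ℕ → C,
        (∀ m, m ≤ k - 1 → ∑ i ∈ Finset.range (m + 1), δ i (α (m - i)) = 0) →
        ∃ β : ℕ → D, β 0 = φ 0 (α 0) ∧
          (∀ m, m ≤ k - 1 → ∑ i ∈ Finset.range (m + 1), d i (β (m - i)) = 0) ∧
          (∑ i ∈ Finset.Icc 1 k, d i (β (k - i))) -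
              φ 0 (∑ i ∈ Finset.Icc 1 k, δ i (α (k - i))) ∈ BSet d (k - 1)) ∧
    -- homotopic morphisms induce the same maps on `Z₀/B₀`
    (∀ a ∈ ZSet δ 0, φ 0 a - φ' 0 a ∈ BSet d 0) := by
  refine ⟨?_, ?_, ?_, ?_⟩
  · rintro k _ ⟨α, rfl, hα⟩
    refine ⟨convApply φ α, convApply_zero φ α, fun m hm => ?_⟩
    exact (congrFun (hφ.convApply_comm α) m).trans
      (convApply_eq_zero φ fun l hl => hα l (hl.trans hm))
  · intro k b hb
    obtain ⟨α, rfl, hα⟩ := mem_BSet_iff.1 hb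
    refine mem_BSet_iff.2 ⟨convApply φ α, ?_, fun m hm => ?_⟩
    · rw [hφ.convApply_comm, convApply_eq_apply_zero φ hα]
    · rw [hφ.convApply_comm, convApply_eq_zero φ fun l hl => hα l (hl.trans_lt hm)]
  · intro k hk α hα
    refine ⟨convApply φ α, convApply_zero φ α, fun m hm => ?_, ?_⟩
    · exact (congrFun (hφ.convApply_comm α) m).trans
        (convApply_eq_zero φ fun l hl => hα l (hl.trans hm))
    · have hcomm := congrFun (hφ.convApply_comm α) k
      have hα' : ∀ l < k, convApply δ α l = 0 := fun l hl => hα l (by omega)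
      rw [convApply_eq_apply_zero φ hα', convApply_eq_add_sum_Icc d,
        convApply_eq_add_sum_Icc δ, map_add] at hcomm
      have hφ₀ : φ 0 (δ 0 (α k)) = d 0 (φ 0 (α k)) := by
        simpa [sub_eq_zero] using hφ 0 (α k)
      rw [hφ₀] at hcomm
      convert apply_zero_mem_BSet d (k - 1) (φ 0 (α k) - convApply φ α k) using 1
      rw [map_sub, sub_eq_sub_iff_add_eq_add, add_comm, hcomm]
  · rintro _ ⟨α, rfl, hα⟩
    have hδα : δ 0 (α 0) = 0 := by simpa using hα 0 le_rfl
    have : φ 0 (α 0) - φ' 0 (α 0) = d 0 (h 0 (α 0)) := by simpa [hδα] using hh 0 (α 0)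
    rw [this]
    exact apply_zero_mem_BSet d 0 _
end

section
/- Let φ : (C, δ) → (D, ∂) be an S¹-morphism where ∂ʳ = 0 for all r ≥ 1 (so ∂⁰ is a differential on D). For α₀ ∈ Z_k(C) with witness family (α₁, …, α_k), set Φᵏ(α₀; α) := ∑_{i=0}^{k} φⁱ(α_{k−i}). Then: (i) ∂⁰(Φᵏ(α₀; α)) = 0; (ii) if α′ = (α′₁, …, α′_k) is another witness family for α₀, then α₁ − α′₁ ∈ Z_{k−1}(C) with witness family (α₂ − α′₂, …, α_k − α′_k), and Φᵏ(α₀; α) − Φᵏ(α₀; α′) = Φ^{k−1}(α₁ − α′₁; α − α′). Hence Φᵏ descends to a well-defined map from ker Δᵏ to the cokernel of Φ^{k−1} (where Φ⁰ = φ⁰ on Z₀(C), with values in H(D, ∂⁰)). -/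
/-!
STATEMENT 9: Let φ : (C, δ) → (D, ∂) be an S¹-morphism where ∂ʳ = 0 for all r ≥ 1
(so ∂⁰ is a differential on D).  For α₀ ∈ Z_k(C) with witness family (α₁, …, α_k),
set Φᵏ(α₀; α) := ∑_{i=0}^{k} φⁱ(α_{k−i}).  Then: (i) ∂⁰(Φᵏ(α₀; α)) = 0; (ii) if
α′ = (α′₁, …, α′_k) is another witness family for α₀, then α₁ − α′₁ ∈ Z_{k−1}(C) with
witness family (α₂ − α′₂, …, α_k − α′_k), and
Φᵏ(α₀; α) − Φᵏ(α₀; α′) = Φ^{k−1}(α₁ − α′₁; α − α′).  Hence Φᵏ descends to a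
well-defined map from ker Δᵏ to the cokernel of Φ^{k−1}.
-/

open Finset

variable {𝕜 : Type*} [Field 𝕜]

/-- If all but the degree-zero operation of the target vanish, the morphism equation in degree `m`
says `∂⁰ ∘ φᵐ = ∑_{i+j=m} φⁱ ∘ δʲ`. -/
lemma IsS1Morphism.d_zero_apply {C D : Type*} [AddCommGroup C] [Module 𝕜 C]
    [AddCommGroup D] [Module 𝕜 D]
    {δ : ℕ → C →ₗ[𝕜] C} {d : ℕ → D →ₗ[𝕜] D} {φ : ℕ → C →ₗ[𝕜] D}
    (hφ : IsS1Morphism δ d φ) (hd : ∀ r : ℕ, 1 ≤ r → d r = 0) (m : ℕ) (c : C) :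
    d 0 (φ m c) = ∑ i ∈ range (m + 1), φ i (δ (m - i) c) := by
  have h := hφ m c
  rw [sum_sub_distrib, sub_eq_zero] at h
  rw [h, sum_eq_single_of_mem m (self_mem_range_succ m)]
  · simp
  · intro i hi him
    rw [mem_range] at hi
    rw [hd (m - i) (by omega), LinearMap.zero_apply]

/-- The value of an `S¹`-morphism on a witness family is closed. -/
lemma IsS1Morphism.d_zero_sum_eq_zero {C D : Type*} [AddCommGroup C] [Module 𝕜 C]
    [AddCommGroup D] [Module 𝕜 D]
    {δ : ℕ → C →ₗ[𝕜] C} {d : ℕ → D →ₗ[𝕜] D} {φ : ℕ → C →ₗ[𝕜] D}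
    (hφ : IsS1Morphism δ d φ) (hd : ∀ r : ℕ, 1 ≤ r → d r = 0) (k : ℕ) (α : ℕ → C)
    (hα : ∀ m, m ≤ k → ∑ i ∈ range (m + 1), δ i (α (m - i)) = 0) :
    d 0 (∑ i ∈ range (k + 1), φ i (α (k - i))) = 0 := by
  have hflip := sum_range_diag_flip (k + 1) fun i j => φ i (δ j (α (k - i - j)))
  calc d 0 (∑ i ∈ range (k + 1), φ i (α (k - i)))
      = ∑ m ∈ range (k + 1), ∑ i ∈ range (m + 1), φ i (δ (m - i) (α (k - i - (m - i)))) := by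
        rw [map_sum]
        refine sum_congr rfl fun m _ => ?_
        rw [hφ.d_zero_apply hd]
        refine sum_congr rfl fun i hi => ?_
        rw [mem_range] at hi
        rw [show k - i - (m - i) = k - m by omega]
    _ = ∑ i ∈ range (k + 1), ∑ j ∈ range (k + 1 - i), φ i (δ j (α (k - i - j))) := hflip
    _ = 0 := by
        refine sum_eq_zero fun i hi => ?_
        rw [mem_range] at hi
        rw [← map_sum, show k + 1 - i = k - i + 1 by omega, hα (k - i) (by omega), map_zero]

/-- The difference of two witness families of the same element, shifted by one, is a witness
family. -/
lemma sum_apply_sub_succ_eq_zero {C : Type*} [AddCommGroup C] [Module 𝕜 C]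
    {δ : ℕ → C →ₗ[𝕜] C} {α α' : ℕ → C} (h0 : α 0 = α' 0) {m : ℕ}
    (hα : ∑ i ∈ range (m + 1 + 1), δ i (α (m + 1 - i)) = 0)
    (hα' : ∑ i ∈ range (m + 1 + 1), δ i (α' (m + 1 - i)) = 0) :
    ∑ i ∈ range (m + 1), δ i (α (m - i + 1) - α' (m - i + 1)) = 0 := by
  have h := sub_eq_zero.2 (hα.trans hα'.symm)
  rw [← sum_sub_distrib, sum_range_succ, Nat.sub_self, h0, sub_self, add_zero] at h
  rw [← h]
  refine sum_congr rfl fun i hi => ?_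
  rw [mem_range] at hi
  rw [map_sub, show m - i + 1 = m + 1 - i by omega]

theorem stmt_9 {C D : Type*} [AddCommGroup C] [Module 𝕜 C]
    [AddCommGroup D] [Module 𝕜 D]
    (δ : ℕ → C →ₗ[𝕜] C) (d : ℕ → D →ₗ[𝕜] D)
    (hδ : IsS1Structure δ) (hd : IsS1Structure d)
    (hd1 : ∀ r : ℕ, 1 ≤ r → d r = 0)
    (φ : ℕ → C →ₗ[𝕜] D) (hφ : IsS1Morphism δ d φ) :
    -- (i) `∂⁰(Φᵏ(α₀; α)) = 0`
    (∀ k : ℕ, ∀ α : ℕ → C,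
        (∀ m, m ≤ k → ∑ i ∈ Finset.range (m + 1), δ i (α (m - i)) = 0) →
        d 0 (∑ i ∈ Finset.range (k + 1), φ i (α (k - i))) = 0) ∧
    -- (ii) independence of the witness family, up to the image of `Φ^{k-1}`
    (∀ k : ℕ, 1 ≤ k → ∀ α α' : ℕ → C, α 0 = α' 0 →
        (∀ m, m ≤ k → ∑ i ∈ Finset.range (m + 1), δ i (α (m - i)) = 0) →
        (∀ m, m ≤ k → ∑ i ∈ Finset.range (m + 1), δ i (α' (m - i)) = 0) →
        -- `α₁ − α′₁ ∈ Z_{k−1}(C)` with witness family `(α₂ − α′₂, …, α_k − α′_k)`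
        ((∀ m, m ≤ k - 1 →
            ∑ i ∈ Finset.range (m + 1), δ i (α (m - i + 1) - α' (m - i + 1)) = 0) ∧
          α 1 - α' 1 ∈ ZSet δ (k - 1) ∧
          -- `Φᵏ(α₀; α) − Φᵏ(α₀; α′) = Φ^{k−1}(α₁ − α′₁; α − α′)`
          (∑ i ∈ Finset.range (k + 1), φ i (α (k - i))) -
              (∑ i ∈ Finset.range (k + 1), φ i (α' (k - i))) =
            ∑ i ∈ Finset.range k, φ i (α (k - i) - α' (k - i)))) := by
  refine ⟨fun k α hα => hφ.d_zero_sum_eq_zero hd1 k α hα, fun k hk α α' h0 hα hα' => ?_⟩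
  have hdiff : ∀ m, m ≤ k - 1 →
      ∑ i ∈ range (m + 1), δ i (α (m - i + 1) - α' (m - i + 1)) = 0 := fun m hm =>
    sum_apply_sub_succ_eq_zero h0 (hα (m + 1) (by omega)) (hα' (m + 1) (by omega))
  refine ⟨hdiff, ⟨fun n => α (n + 1) - α' (n + 1), rfl, hdiff⟩, ?_⟩
  rw [← sum_sub_distrib, sum_range_succ, Nat.sub_self, h0, sub_self, add_zero]
  simp only [map_sub]
end

section
/- Let φ : (C, δ) → (D, ∂) and φ̃ : (C̃, δ̃) → (D̃, ∂̃) be S¹-morphisms with ∂ʳ = ∂̃ʳ = 0 for r ≥ 1, let ψ : (C, δ) → (C̃, δ̃) be an S¹-morphism, let f : (D, ∂) → (D̃, ∂̃) be an S¹-morphism with fʳ = 0 for r ≥ 1, and suppose f ∘ φ and φ̃ ∘ ψ are S¹-homotopic. Then for every k ≥ 0 and every α₀ ∈ Z_k(C) with witness family (α₁, …, α_k), setting βⱼ := ∑_{m=0}^{j} ψᵐ(α_{j−m}) for 0 ≤ j ≤ k, one has: β₀ = ψ⁰(α₀) lies in Z_k(C̃) with witness family (β₁, …, β_k), and f⁰(∑_{i=0}^{k}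 φⁱ(α_{k−i})) − ∑_{i=0}^{k} φ̃ⁱ(β_{k−i}) ∈ Im ∂̃⁰. Hence the square f⁰ ∘ Φᵏ = Φ̃ᵏ ∘ ψ⁰ commutes as maps from ker Δᵏ(C) to the cokernel of Φ̃^{k−1}. -/
/-!
STATEMENT 10: Let φ : (C, δ) → (D, ∂) and φ̃ : (C̃, δ̃) → (D̃, ∂̃) be S¹-morphisms with
∂ʳ = ∂̃ʳ = 0 for r ≥ 1, let ψ : (C, δ) → (C̃, δ̃) be an S¹-morphism, let
f : (D, ∂) → (D̃, ∂̃) be an S¹-morphism with fʳ = 0 for r ≥ 1, and suppose f ∘ φ and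
φ̃ ∘ ψ are S¹-homotopic.  Then for every k ≥ 0 and every α₀ ∈ Z_k(C) with witness
family (α₁, …, α_k), setting βⱼ := ∑_{m=0}^{j} ψᵐ(α_{j−m}) for 0 ≤ j ≤ k, one has:
β₀ = ψ⁰(α₀) lies in Z_k(C̃) with witness family (β₁, …, β_k), and
f⁰(∑_{i=0}^{k} φⁱ(α_{k−i})) − ∑_{i=0}^{k} φ̃ⁱ(β_{k−i}) ∈ Im ∂̃⁰.  Hence the square
f⁰ ∘ Φᵏ = Φ̃ᵏ ∘ ψ⁰ commutes as maps from ker Δᵏ(C) to the cokernel of Φ̃^{k−1}.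

(Here the composition `f ∘ φ` of S¹-morphisms is `(f ∘ φ)ᵐ = ∑_{i+j=m} fⁱ ∘ φʲ`.)
-/

open Finset

variable {𝕜 : Type*} [Field 𝕜]

/-- Triple convolution over `ℕ` may be bracketed either way. -/
theorem sum_range_conv_assoc {M : Type*} [AddCommMonoid M] (g : ℕ → ℕ → ℕ → M) (m : ℕ) :
    ∑ i ∈ Finset.range (m + 1), ∑ l ∈ Finset.range (m - i + 1), g i l (m - i - l) =
      ∑ n ∈ Finset.range (m + 1), ∑ i ∈ Finset.range (n + 1), g i (n - i) (m - n) := by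
  rw [Finset.sum_sigma', Finset.sum_sigma']
  refine Finset.sum_nbij' (fun x => ⟨x.1 + x.2, x.1⟩) (fun x => ⟨x.2, x.1 - x.2⟩) ?_ ?_ ?_ ?_ ?_
  · simp only [Finset.mem_sigma, Finset.mem_range]; omega
  · simp only [Finset.mem_sigma, Finset.mem_range]; omega
  · rintro ⟨i, l⟩ -
    simp
  · rintro ⟨n, i⟩ hx
    simp only [Finset.mem_sigma, Finset.mem_range] at hx
    simp [show i + (n - i) = n by omega]
  · rintro ⟨i, l⟩ -
    simp [Nat.sub_sub]

/-- Applying a sequence of linear maps to the convolution of another with `a`. -/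
theorem sum_range_map_conv {X Y Z : Type*} [AddCommGroup X] [Module 𝕜 X]
    [AddCommGroup Y] [Module 𝕜 Y] [AddCommGroup Z] [Module 𝕜 Z]
    (F : ℕ → Y →ₗ[𝕜] Z) (G : ℕ → X →ₗ[𝕜] Y) (a : ℕ → X) (m : ℕ) :
    ∑ i ∈ Finset.range (m + 1), F i (∑ l ∈ Finset.range (m - i + 1), G l (a (m - i - l))) =
      ∑ n ∈ Finset.range (m + 1), ∑ i ∈ Finset.range (n + 1), F i (G (n - i) (a (m - n))) := by
  simp only [map_sum]
  exact sum_range_conv_assoc (fun i l q => F i (G l (a q))) m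

/-- The image of a witness family under a sequence of linear maps vanishes. -/
theorem sum_range_conv_eq_zero_of_witness {X Z : Type*} [AddCommGroup X] [Module 𝕜 X]
    [AddCommGroup Z] [Module 𝕜 Z] (F : ℕ → X →ₗ[𝕜] Z) (δ : ℕ → X →ₗ[𝕜] X) (a : ℕ → X)
    {k : ℕ} (ha : ∀ m, m ≤ k → ∑ i ∈ Finset.range (m + 1), δ i (a (m - i)) = 0)
    {m : ℕ} (hm : m ≤ k) :
    ∑ n ∈ Finset.range (m + 1), ∑ i ∈ Finset.range (n + 1), F i (δ (n - i) (a (m - n))) = 0 := by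
  rw [← sum_range_map_conv]
  refine Finset.sum_eq_zero fun i _ => ?_
  rw [ha (m - i) ((Nat.sub_le m i).trans hm), map_zero]

theorem IsS1Morphism.sum_comp_eq {X Y : Type*} [AddCommGroup X] [Module 𝕜 X]
    [AddCommGroup Y] [Module 𝕜 Y] {δ : ℕ → X →ₗ[𝕜] X} {d : ℕ → Y →ₗ[𝕜] Y}
    {ψ : ℕ → X →ₗ[𝕜] Y} (hψ : IsS1Morphism δ d ψ) (n : ℕ) (c : X) :
    ∑ i ∈ Finset.range (n + 1), d i (ψ (n - i) c) =
      ∑ i ∈ Finset.range (n + 1), ψ i (δ (n - i) c) := by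
  have key := hψ n c
  rw [Finset.sum_sub_distrib, sub_eq_zero] at key
  rw [key, ← Finset.sum_range_reflect]
  refine Finset.sum_congr rfl fun i hi => ?_
  have hi' : i ≤ n := Nat.lt_succ_iff.mp (Finset.mem_range.mp hi)
  rw [Nat.add_sub_cancel, Nat.sub_sub_self hi']

theorem stmt_10 {C Ct D Dt : Type*}
    [AddCommGroup C] [Module 𝕜 C] [AddCommGroup Ct] [Module 𝕜 Ct]
    [AddCommGroup D] [Module 𝕜 D] [AddCommGroup Dt] [Module 𝕜 Dt]
    (δC : ℕ → C →ₗ[𝕜] C) (δCt : ℕ → Ct →ₗ[𝕜] Ct)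
    (dD : ℕ → D →ₗ[𝕜] D) (dDt : ℕ → Dt →ₗ[𝕜] Dt)
    (hδC : IsS1Structure δC) (hδCt : IsS1Structure δCt)
    (hdD : IsS1Structure dD) (hdDt : IsS1Structure dDt)
    (hdD1 : ∀ r : ℕ, 1 ≤ r → dD r = 0) (hdDt1 : ∀ r : ℕ, 1 ≤ r → dDt r = 0)
    (φ : ℕ → C →ₗ[𝕜] D) (hφ : IsS1Morphism δC dD φ)
    (φt : ℕ → Ct →ₗ[𝕜] Dt) (hφt : IsS1Morphism δCt dDt φt)
    (ψ : ℕ → C →ₗ[𝕜] Ct) (hψ : IsS1Morphism δC δCt ψ)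
    (f : ℕ → D →ₗ[𝕜] Dt) (hf : IsS1Morphism dD dDt f)
    (hf1 : ∀ r : ℕ, 1 ≤ r → f r = 0)
    -- `h` is an `S¹`-homotopy between the compositions `f ∘ φ` and `φ̃ ∘ ψ`
    (h : ℕ → C →ₗ[𝕜] Dt)
    (hh : ∀ m : ℕ, ∀ c : C,
        (∑ i ∈ Finset.range (m + 1), f i (φ (m - i) c)) -
            (∑ i ∈ Finset.range (m + 1), φt i (ψ (m - i) c)) =
          ∑ i ∈ Finset.range (m + 1), (h i (δC (m - i) c) + dDt (m - i) (h i c))) :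
    ∀ k : ℕ, ∀ α : ℕ → C,
      -- `α 0 ∈ Z_k(C)` with witness family `(α 1, …, α k)`
      (∀ m, m ≤ k → ∑ i ∈ Finset.range (m + 1), δC i (α (m - i)) = 0) →
      -- `β₀ = ψ⁰(α₀)` lies in `Z_k(C̃)` with witness family `(β₁, …, β_k)`,
      -- where `βⱼ = ∑_{m=0}^{j} ψᵐ(α_{j−m})`
      ((∀ m, m ≤ k → ∑ i ∈ Finset.range (m + 1),
          δCt i (∑ l ∈ Finset.range (m - i + 1), ψ l (α (m - i - l))) = 0) ∧
        -- `f⁰(Φᵏ(α)) − Φ̃ᵏ(β) ∈ Im ∂̃⁰`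
        ∃ e : Dt,
          f 0 (∑ i ∈ Finset.range (k + 1), φ i (α (k - i))) -
              (∑ i ∈ Finset.range (k + 1),
                φt i (∑ l ∈ Finset.range (k - i + 1), ψ l (α (k - i - l)))) =
            dDt 0 e) := by
  intro k α hα
  refine ⟨fun m hm => ?_, ∑ n ∈ Finset.range (k + 1), h n (α (k - n)), ?_⟩
  · simp only [sum_range_map_conv, hψ.sum_comp_eq]
    exact sum_range_conv_eq_zero_of_witness ψ δC α hα hm
  · have hf0 (n : ℕ) (c : C) :
        ∑ i ∈ Finset.range (n + 1), f i (φ (n - i) c) = f 0 (φ n c) := by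
      rw [Finset.sum_range_succ', Finset.sum_eq_zero, zero_add, Nat.sub_zero]
      intro i _
      rw [hf1 (i + 1) (Nat.le_add_left 1 i), LinearMap.zero_apply]
    have hd0 (n : ℕ) (c : C) :
        ∑ i ∈ Finset.range (n + 1), dDt (n - i) (h i c) = dDt 0 (h n c) := by
      rw [Finset.sum_range_succ, Finset.sum_eq_zero, zero_add, Nat.sub_self]
      intro i hi
      rw [hdDt1 (n - i) (Nat.sub_pos_of_lt (Finset.mem_range.mp hi)), LinearMap.zero_apply]
    simp only [hf0, Finset.sum_add_distrib, hd0] at hh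
    rw [sum_range_map_conv, map_sum, map_sum, ← Finset.sum_sub_distrib]
    simp only [hh, Finset.sum_add_distrib]
    rw [sum_range_conv_eq_zero_of_witness h δC α hα le_rfl, zero_add]
end

section
/- Let δ be an S¹-structure (or an N-truncated S¹-structure) on a 𝕜-module C compatible with a splitting C = C₀ ⊕ C₊, with distinguished element e and functional p as in the definitions. Then: (i) if the structure carries a k-dilation, it carries a k-semi-dilation (assuming k ≤ N in the truncated case); (ii) if the structure carries a k-dilation (respectively, a k-semi-dilation), then it carries a (k+1)-dilation (respectively, a (k+1)-semi-dilation) (assuming k+1 ≤ N in the truncated case). -/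
/-!
STATEMENT 11: Let δ be an S¹-structure (or an N-truncated S¹-structure) on a 𝕜-module
C compatible with a splitting C = C₀ ⊕ C₊, with distinguished element e and functional
p as in the definitions.  Then: (i) if the structure carries a k-dilation, it carries a
k-semi-dilation (assuming k ≤ N in the truncated case); (ii) if the structure carries a
k-dilation (respectively, a k-semi-dilation), then it carries a (k+1)-dilation
(respectively, a (k+1)-semi-dilation) (assuming k+1 ≤ N in the truncated case).

The splitting `C = C₀ ⊕ C₊` is modelled by `C = C0 × Cp`.  The `N`-truncated case is
formalized (a full `S¹`-structure satisfies the hypothesis for every `N`, so the full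
case is the special case where the truncation hypothesis holds for all `m`).
An element `A = ∑_{i=0}^{k} c_i u^{-i} ∈ FᵏC⁺` is encoded by its coefficient function
`A : ℕ → C` vanishing for indices `> k`; `δ^{S¹}(A) = e·u⁰` says that the coefficient
of `u^{-j}` in `δ^{S¹}(A)`, namely `∑_i δⁱ(A_{j+i})`, is `e` for `j = 0` and `0`
otherwise.
-/

open Finset

variable {𝕜 : Type*} [Field 𝕜] {C0 Cp : Type*} [AddCommGroup C0] [Module 𝕜 C0]
  [AddCommGroup Cp] [Module 𝕜 Cp]

/-- The structure carries a `k`-dilation: there is `A ∈ FᵏC⁺` with `δ^{S¹}(A) = e·u⁰`. -/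
def DilationAt (δ : ℕ → (C0 × Cp) →ₗ[𝕜] C0 × Cp) (e : C0) (k : ℕ) : Prop :=
  ∃ A : ℕ → C0 × Cp, (∀ j, k < j → A j = 0) ∧
    ∀ j : ℕ, (∑ i ∈ Finset.range (k + 1), δ i (A (j + i))) =
      if j = 0 then ((e, 0) : C0 × Cp) else 0

/-- The structure carries a `k`-semi-dilation: there is `A = ∑_{i=0}^{k} α_{k−i}u^{-i}`
with all `αᵢ ∈ C₊`, `∑_{i=0}^{m} δⁱ₊(α_{m−i}) = 0` for all `0 ≤ m ≤ k`, and
`p(∑_{i=0}^{k} δⁱ₊,₀(α_{k−i})) = 1`. -/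
def SemiDilationAt (δ : ℕ → (C0 × Cp) →ₗ[𝕜] C0 × Cp) (p : C0 →ₗ[𝕜] 𝕜) (k : ℕ) : Prop :=
  ∃ α : ℕ → Cp,
    (∀ m, m ≤ k → ∑ i ∈ Finset.range (m + 1), deltaPlus δ i (α (m - i)) = 0) ∧
    p (∑ i ∈ Finset.range (k + 1), deltaPlusZero δ i (α (k - i))) = 1

theorem DilationAt.succ {δ : ℕ → (C0 × Cp) →ₗ[𝕜] C0 × Cp} {e : C0} {k : ℕ}
    (h : DilationAt δ e k) : DilationAt δ e (k + 1) := by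
  obtain ⟨A, hA, hsum⟩ := h
  refine ⟨A, fun j hj => hA j (by omega), fun j => ?_⟩
  rw [Finset.sum_range_succ, hsum j, hA (j + (k + 1)) (by omega), map_zero, add_zero]

theorem sum_range_succ_apply_cons {M : Type*} [AddCommGroup M] [Module 𝕜 M]
    (f : ℕ → Cp →ₗ[𝕜] M) (α : ℕ → Cp) (m : ℕ) :
    ∑ i ∈ Finset.range (m + 1 + 1), f i (Nat.casesOn (m + 1 - i) 0 α) =
      ∑ i ∈ Finset.range (m + 1), f i (α (m - i)) := by
  rw [Finset.sum_range_succ, Nat.sub_self]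
  refine (add_eq_left.mpr (map_zero (f (m + 1)))).trans ?_
  refine Finset.sum_congr rfl fun i hi => ?_
  rw [Nat.succ_sub (Finset.mem_range_succ_iff.mp hi)]

theorem SemiDilationAt.succ {δ : ℕ → (C0 × Cp) →ₗ[𝕜] C0 × Cp} {p : C0 →ₗ[𝕜] 𝕜} {k : ℕ}
    (h : SemiDilationAt δ p k) : SemiDilationAt δ p (k + 1) := by
  obtain ⟨α, hα, hsum⟩ := h
  refine ⟨fun n => Nat.casesOn n 0 α, fun m hm => ?_, ?_⟩
  · cases m with
    | zero => simp
    | succ m => exact (sum_range_succ_apply_cons _ α m).trans (hα m (by omega))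
  · exact (congrArg p (sum_range_succ_apply_cons _ α k)).trans hsum

theorem DilationAt.semiDilationAt {δ : ℕ → (C0 × Cp) →ₗ[𝕜] C0 × Cp} {e : C0}
    {p : C0 →ₗ[𝕜] 𝕜} {k : ℕ}
    (hcomp0 : ∀ c : C0, (δ 0 (c, 0)).2 = 0)
    (hcomp : ∀ i, 1 ≤ i → ∀ c : C0, δ i (c, 0) = 0)
    (hp0 : ∀ c : C0, p ((δ 0 (c, 0)).1) = 0) (hpe : p e = 1)
    (h : DilationAt δ e k) : SemiDilationAt δ p k := by
  obtain ⟨A, hA, hsum⟩ := h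
  have split (i : ℕ) (x : C0 × Cp) : δ i x = δ i (x.1, 0) + δ i (0, x.2) := by
    rw [← map_add]; simp
  have snd_eq (i : ℕ) (x : C0 × Cp) : (δ i x).2 = deltaPlus δ i x.2 := by
    have h0 : (δ i (x.1, 0)).2 = 0 := by
      cases i with
      | zero => exact hcomp0 _
      | succ i => rw [hcomp _ (by omega)]; rfl
    rw [split, Prod.snd_add, h0, zero_add]
    rfl
  have fst_eq (i : ℕ) (x : C0 × Cp) : p (δ i x).1 = p (deltaPlusZero δ i x.2) := by
    have h0 : p (δ i (x.1, 0)).1 = 0 := by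
      cases i with
      | zero => exact hp0 _
      | succ i => rw [hcomp _ (by omega)]; exact map_zero p
    rw [split, Prod.fst_add, map_add, h0, zero_add]
    rfl
  refine ⟨fun j => (A (k - j)).2, fun m hm => ?_, ?_⟩
  · have hj : (∑ i ∈ Finset.range (k + 1), δ i (A (k - m + i))).2 = 0 := by
      rw [hsum]; split_ifs <;> rfl
    rw [Prod.snd_sum] at hj
    rw [← hj]
    refine (Finset.sum_congr rfl fun i hi => ?_).trans
      (Finset.sum_subset (Finset.range_mono (by omega : m + 1 ≤ k + 1)) fun i _ hi => ?_)
    · beta_reduce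
      rw [snd_eq, show k - (m - i) = k - m + i by have := Finset.mem_range.mp hi; omega]
    · rw [hA _ (by have := Finset.mem_range.not.mp hi; omega), map_zero]; rfl
  · have hj := congrArg (fun x => p x.1) (hsum 0)
    simp only [if_true, Prod.fst_sum, map_sum, hpe, fst_eq, zero_add] at hj
    rw [map_sum, ← hj]
    refine Finset.sum_congr rfl fun i hi => ?_
    beta_reduce
    rw [Nat.sub_sub_self (Finset.mem_range_succ_iff.mp hi)]

theorem stmt_11 (N : ℕ) (δ : ℕ → (C0 × Cp) →ₗ[𝕜] C0 × Cp)
    -- `δ` is an `N`-truncated `S¹`-structure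
    (hδ : ∀ m ≤ N, ∀ c : C0 × Cp, ∑ i ∈ Finset.range (m + 1), δ i (δ (m - i) c) = 0)
    -- compatibility with the splitting
    (hcomp0 : ∀ c : C0, (δ 0 (c, 0)).2 = 0)
    (hcomp : ∀ i, 1 ≤ i → ∀ c : C0, δ i (c, 0) = 0)
    -- distinguished element `e ∈ C₀` with `δ⁰(e) = 0`
    (e : C0) (he : δ 0 (e, 0) = 0)
    -- preferred projection `p : C₀ → 𝕜` with `p ∘ δ⁰|_{C₀} = 0` and `p(e) = 1`
    (p : C0 →ₗ[𝕜] 𝕜) (hp0 : ∀ c : C0, p ((δ 0 (c, 0)).1) = 0) (hpe : p e = 1) :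
    -- (i) a `k`-dilation gives a `k`-semi-dilation
    (∀ k ≤ N, DilationAt δ e k → SemiDilationAt δ p k) ∧
    -- (ii) a `k`-dilation gives a `(k+1)`-dilation
    (∀ k : ℕ, k + 1 ≤ N → DilationAt δ e k → DilationAt δ e (k + 1)) ∧
    -- (ii') a `k`-semi-dilation gives a `(k+1)`-semi-dilation
    (∀ k : ℕ, k + 1 ≤ N → SemiDilationAt δ p k → SemiDilationAt δ p (k + 1)) := by
  exact ⟨fun _ _ => DilationAt.semiDilationAt hcomp0 hcomp hp0 hpe,
    fun _ _ => DilationAt.succ, fun _ _ => SemiDilationAt.succ⟩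
end

section
/- Let δ be an S¹-structure on a 𝕜-module C compatible with a splitting C = C₀ ⊕ C₊, with distinguished element e and functional p as in the definitions. Let C₊⁺ and C₀⁺ denote the polynomial modules built from C₊ and C₀, with δ^{S¹}₊ acting by (δ^{S¹}₊x)ⱼ = ∑_i δⁱ₊(x_{j+i}), δ^{S¹}₀ acting componentwise by δ⁰₀, and δ^{S¹}₊,₀ : C₊⁺ → C₀⁺ given by (δ^{S¹}₊,₀x)ⱼ = ∑_i δⁱ₊,₀(x_{j+i}). Then: (a) the structure carries a k-dilation if and only if there exists x ∈ C₊⁺ with δ^{S¹}₊(x) = 0, δ^{S¹}₊,₀(x) − e·u⁰ ∈ Im δ^{S¹}₀, and u^{k+1}·x ∈ Im δ^{S¹}₊; (b) the structure carries a k-semi-dilation if and only if there exists x ∈ C₊⁺ with δ^{S¹}₊(x) = 0, p((δ^{S¹}₊,₀(x))₀) = 1 (where (·)₀ is the coefficient of u⁰), and u^{k+1}·x ∈ Im δ^{S¹}₊. -/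
/-!
STATEMENT 12: Let δ be an S¹-structure on a 𝕜-module C compatible with a splitting
C = C₀ ⊕ C₊, with distinguished element e and functional p.  Let C₊⁺ and C₀⁺ denote
the polynomial modules built from C₊ and C₀, with δ^{S¹}₊ acting by
(δ^{S¹}₊x)ⱼ = ∑_i δⁱ₊(x_{j+i}), δ^{S¹}₀ acting componentwise by δ⁰₀, and
δ^{S¹}₊,₀ : C₊⁺ → C₀⁺ given by (δ^{S¹}₊,₀x)ⱼ = ∑_i δⁱ₊,₀(x_{j+i}).  Then:
(a) the structure carries a k-dilation iff there exists x ∈ C₊⁺ with δ^{S¹}₊(x) = 0,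
δ^{S¹}₊,₀(x) − e·u⁰ ∈ Im δ^{S¹}₀, and u^{k+1}·x ∈ Im δ^{S¹}₊;
(b) the structure carries a k-semi-dilation iff there exists x ∈ C₊⁺ with
δ^{S¹}₊(x) = 0, p((δ^{S¹}₊,₀(x))₀) = 1, and u^{k+1}·x ∈ Im δ^{S¹}₊.

The splitting is modelled by `C = C0 × Cp`; elements of `C₊⁺` (resp. `C₀⁺`) are
finitely supported functions `ℕ →₀ Cp` (resp. `ℕ →₀ C0`), the coefficient of `u^{-j}`
being the value at `j`; `(u^{k+1}·x)ⱼ = x_{j+k+1}`.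
-/

open Finset

variable {𝕜 : Type*} [Field 𝕜] {C0 Cp : Type*} [AddCommGroup C0] [Module 𝕜 C0]
  [AddCommGroup Cp] [Module 𝕜 Cp]

/-- For a sequence of maps `d = (d⁰, d¹, …)` the operator
`(d^{S¹}x)ⱼ = ∑_{i ≥ 0} dⁱ(x_{j+i})` on finitely supported coefficient functions. -/
def dS1 {M M' : Type*} [AddCommGroup M] [Module 𝕜 M] [AddCommGroup M'] [Module 𝕜 M']
    (d : ℕ → M →ₗ[𝕜] M') (x : ℕ →₀ M) : ℕ → M' :=
  fun j => ∑ i ∈ x.support, if j ≤ i then d (i - j) (x i) else 0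

theorem exists_forall_ge_eq_zero {M : Type*} [AddCommGroup M] (x : ℕ →₀ M) :
    ∃ n, ∀ i, n ≤ i → x i = 0 := by
  obtain ⟨n, hn⟩ := x.support.exists_nat_subset_range
  refine ⟨n, fun i hi => ?_⟩
  by_contra h
  have := Finset.mem_range.mp (hn (Finsupp.mem_support_iff.mpr h))
  omega

section dS1

variable {M M' M'' : Type*} [AddCommGroup M] [Module 𝕜 M] [AddCommGroup M'] [Module 𝕜 M']
  [AddCommGroup M''] [Module 𝕜 M'']

theorem dS1_eq_sum_range (d : ℕ → M →ₗ[𝕜] M') {x : ℕ →₀ M} {n : ℕ}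
    (h : ∀ i, n ≤ i → x i = 0) {j m : ℕ} (hm : n ≤ j + m) :
    dS1 d x j = ∑ i ∈ Finset.range m, d i (x (j + i)) := by
  have hsub : x.support ⊆ Finset.range (j + m) := fun i hi => by
    by_contra hc
    exact Finsupp.mem_support_iff.mp hi (h i (by simp at hc; omega))
  unfold dS1
  rw [Finset.sum_subset hsub, Finset.sum_range_add, Finset.sum_eq_zero, zero_add]
  · exact Finset.sum_congr rfl fun i _ => by simp
  · intro i hi
    rw [if_neg (by simpa using hi)]
  · intro i _ hi
    simp [Finsupp.notMem_support_iff.mp hi]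

theorem dS1_sub (d : ℕ → M →ₗ[𝕜] M') (x y : ℕ →₀ M) (j : ℕ) :
    dS1 d (x - y) j = dS1 d x j - dS1 d y j := by
  obtain ⟨n, hn⟩ := exists_forall_ge_eq_zero x
  obtain ⟨n', hn'⟩ := exists_forall_ge_eq_zero y
  have hx : ∀ i, n + n' ≤ i → x i = 0 := fun i hi => hn i (by omega)
  have hy : ∀ i, n + n' ≤ i → y i = 0 := fun i hi => hn' i (by omega)
  have hxy : ∀ i, n + n' ≤ i → (x - y) i = 0 := fun i hi => by simp [hx i hi, hy i hi]
  have hm : n + n' ≤ j + (n + n') := by omega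
  rw [dS1_eq_sum_range d hx hm, dS1_eq_sum_range d hy hm, dS1_eq_sum_range d hxy hm]
  simp

theorem exists_finsupp_eq_dS1 (d : ℕ → M →ₗ[𝕜] M') (x : ℕ →₀ M) :
    ∃ v : ℕ →₀ M', ∀ j, v j = dS1 d x j := by
  obtain ⟨n, hn⟩ := exists_forall_ge_eq_zero x
  refine ⟨Finsupp.onFinset (Finset.range n) (dS1 d x) fun j hj => ?_, fun j => rfl⟩
  by_contra hc
  exact hj (by rw [dS1_eq_sum_range d hn (m := 0) (by simpa using hc)]; simp)

theorem dS1_comp (d : ℕ → M →ₗ[𝕜] M') (d' : ℕ → M' →ₗ[𝕜] M'') {x : ℕ →₀ M} {v : ℕ →₀ M'}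
    (hv : ∀ j, v j = dS1 d x j) {n : ℕ} (hn : ∀ i, n ≤ i → x i = 0) (j : ℕ) :
    dS1 d' v j =
      ∑ m ∈ Finset.range n, ∑ i ∈ Finset.range (m + 1), d' i (d (m - i) (x (j + m))) := by
  have hvn : ∀ i, n ≤ i → v i = 0 := fun i hi => by
    rw [hv, dS1_eq_sum_range d hn (m := 0) (by simpa using hi)]; simp
  rw [dS1_eq_sum_range d' hvn (m := n) (by omega)]
  have h := Finset.sum_range_diag_flip n fun i l => d' i (d l (x (j + (i + l))))
  trans ∑ m ∈ Finset.range n, ∑ l ∈ Finset.range (n - m), d' m (d l (x (j + (m + l))))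
  · refine Finset.sum_congr rfl fun i hi => ?_
    rw [hv, dS1_eq_sum_range d hn (m := n - i) (by omega), map_sum]
    simp only [add_assoc]
  · rw [← h]
    refine Finset.sum_congr rfl fun m _ => Finset.sum_congr rfl fun i hi => ?_
    rw [Nat.add_sub_cancel' (by simp at hi; omega)]

theorem dS1_shift (d : ℕ → M →ₗ[𝕜] M') {x y : ℕ →₀ M} {k : ℕ}
    (h : ∀ i, y (i + k) = x i) (j : ℕ) : dS1 d y (j + k) = dS1 d x j := by
  obtain ⟨n, hn⟩ := exists_forall_ge_eq_zero x
  have hy : ∀ i, n + k ≤ i → y i = 0 := fun i hi => by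
    rw [show i = (i - k) + k by omega, h, hn _ (by omega)]
  rw [dS1_eq_sum_range d hn (m := n) (by omega),
    dS1_eq_sum_range d hy (m := n) (by omega)]
  refine Finset.sum_congr rfl fun i _ => ?_
  rw [← h, add_right_comm]

end dS1

section components

variable (δ : ℕ → (C0 × Cp) →ₗ[𝕜] C0 × Cp)

theorem apply_eq_components (hcomp0 : ∀ c : C0, (δ 0 (c, 0)).2 = 0)
    (hcomp : ∀ i, 1 ≤ i → ∀ c : C0, δ i (c, 0) = 0) (i : ℕ) (a : C0) (b : Cp) :
    δ i (a, b) = (deltaZero δ i a + deltaPlusZero δ i b, deltaPlus δ i b) := by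
  have h : ((a, b) : C0 × Cp) = (a, 0) + (0, b) := by simp
  have h2 : (δ i (a, 0)).2 = 0 := by
    rcases Nat.eq_zero_or_pos i with rfl | hi
    · exact hcomp0 a
    · simp [hcomp i hi a]
  rw [h, map_add]
  ext <;> simp [deltaZero, deltaPlusZero, deltaPlus, h2]

theorem deltaZero_eq_zero (hcomp : ∀ i, 1 ≤ i → ∀ c : C0, δ i (c, 0) = 0) {i : ℕ}
    (hi : 1 ≤ i) (a : C0) : deltaZero δ i a = 0 := by
  simp [deltaZero, hcomp i hi a]

theorem sum_deltaZero (hcomp : ∀ i, 1 ≤ i → ∀ c : C0, δ i (c, 0) = 0) (m : ℕ) (a : ℕ → C0) :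
    ∑ i ∈ Finset.range (m + 1), deltaZero δ i (a i) = deltaZero δ 0 (a 0) := by
  rw [Finset.sum_range_succ', Finset.sum_eq_zero, zero_add]
  exact fun i _ => deltaZero_eq_zero δ hcomp (by omega) _

variable {δ}

theorem IsS1Structure.deltaPlus (hδ : IsS1Structure δ)
    (hcomp0 : ∀ c : C0, (δ 0 (c, 0)).2 = 0)
    (hcomp : ∀ i, 1 ≤ i → ∀ c : C0, δ i (c, 0) = 0) : IsS1Structure (deltaPlus δ) := by
  intro m b
  have h := congrArg Prod.snd (hδ m (0, b))
  simpa [apply_eq_components δ hcomp0 hcomp, Prod.snd_sum] using h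

theorem IsS1Structure.sum_deltaPlusZero_deltaPlus (hδ : IsS1Structure δ)
    (hcomp0 : ∀ c : C0, (δ 0 (c, 0)).2 = 0)
    (hcomp : ∀ i, 1 ≤ i → ∀ c : C0, δ i (c, 0) = 0) (m : ℕ) (b : Cp) :
    ∑ i ∈ Finset.range (m + 1), deltaPlusZero δ i (_root_.deltaPlus δ (m - i) b) =
      -deltaZero δ 0 (deltaPlusZero δ m b) := by
  have h := congrArg Prod.fst (hδ m (0, b))
  simp only [apply_eq_components δ hcomp0 hcomp, Prod.fst_sum, map_zero, zero_add,
    Finset.sum_add_distrib, Prod.fst_zero] at h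
  rw [sum_deltaZero δ hcomp m fun i => deltaPlusZero δ (m - i) b] at h
  exact eq_neg_of_add_eq_zero_right h

theorem IsS1Structure.exists_truncated_cycle (hδ : IsS1Structure δ)
    (hcomp0 : ∀ c : C0, (δ 0 (c, 0)).2 = 0)
    (hcomp : ∀ i, 1 ≤ i → ∀ c : C0, δ i (c, 0) = 0) {k : ℕ} {x z : ℕ →₀ Cp}
    (hx : ∀ j, dS1 (_root_.deltaPlus δ) x j = 0)
    (hz : ∀ j, dS1 (_root_.deltaPlus δ) z j = x (j + (k + 1))) :
    ∃ x' w : ℕ →₀ Cp, (∀ i, k + 1 ≤ i → x' i = 0) ∧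
      (∀ j, dS1 (_root_.deltaPlus δ) x' j = 0) ∧
      ∀ j, dS1 (deltaPlusZero δ) x' j =
        dS1 (deltaPlusZero δ) x j + deltaZero δ 0 (dS1 (deltaPlusZero δ) w j) := by
  let w : ℕ →₀ Cp := z.mapDomain (· + (k + 1))
  have hw : ∀ i, w (i + (k + 1)) = z i := fun i =>
    Finsupp.mapDomain_apply (add_left_injective (k + 1)) z i
  obtain ⟨v, hv⟩ := exists_finsupp_eq_dS1 (_root_.deltaPlus δ) w
  obtain ⟨n, hn⟩ := exists_forall_ge_eq_zero w
  refine ⟨x - v, w, fun i hi => ?_, fun j => ?_, fun j => ?_⟩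
  · obtain ⟨j, rfl⟩ := Nat.exists_eq_add_of_le' hi
    rw [Finsupp.sub_apply, hv, dS1_shift _ hw, hz, sub_self]
  · rw [dS1_sub, hx, dS1_comp _ _ hv hn, Finset.sum_eq_zero, sub_zero]
    exact fun m _ => hδ.deltaPlus hcomp0 hcomp m _
  · rw [dS1_sub, dS1_comp _ _ hv hn, dS1_eq_sum_range _ hn (j := j) (m := n) (by omega) (x := w)]
    simp only [hδ.sum_deltaPlusZero_deltaPlus hcomp0 hcomp]
    rw [Finset.sum_neg_distrib, sub_neg_eq_add, map_sum]

end components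

theorem stmt_12 (δ : ℕ → (C0 × Cp) →ₗ[𝕜] C0 × Cp) (hδ : IsS1Structure δ)
    (hcomp0 : ∀ c : C0, (δ 0 (c, 0)).2 = 0)
    (hcomp : ∀ i, 1 ≤ i → ∀ c : C0, δ i (c, 0) = 0)
    (e : C0) (he : δ 0 (e, 0) = 0)
    (p : C0 →ₗ[𝕜] 𝕜) (hp0 : ∀ c : C0, p ((δ 0 (c, 0)).1) = 0) (hpe : p e = 1)
    (k : ℕ) :
    -- (a)
    (DilationAt δ e k ↔
      ∃ x : ℕ →₀ Cp,
        -- `δ^{S¹}₊(x) = 0`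
        (∀ j, dS1 (deltaPlus δ) x j = 0) ∧
        -- `δ^{S¹}₊,₀(x) − e·u⁰ ∈ Im δ^{S¹}₀`
        (∃ y : ℕ →₀ C0, ∀ j, deltaZero δ 0 (y j) =
            dS1 (deltaPlusZero δ) x j - (if j = 0 then e else 0)) ∧
        -- `u^{k+1}·x ∈ Im δ^{S¹}₊`
        (∃ z : ℕ →₀ Cp, ∀ j, dS1 (deltaPlus δ) z j = x (j + (k + 1)))) ∧
    -- (b)
    (SemiDilationAt δ p k ↔
      ∃ x : ℕ →₀ Cp,
        (∀ j, dS1 (deltaPlus δ) x j = 0) ∧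
        p (dS1 (deltaPlusZero δ) x 0) = 1 ∧
        (∃ z : ℕ →₀ Cp, ∀ j, dS1 (deltaPlus δ) z j = x (j + (k + 1)))) := by
  have hbound : ∀ x : ℕ → Cp, ∃ y : ℕ →₀ Cp,
      (∀ i, i ≤ k → y i = x i) ∧ ∀ i, k + 1 ≤ i → y i = 0 := fun x => by
    refine ⟨Finsupp.onFinset (Finset.range (k + 1)) (fun i => if i ≤ k then x i else 0) ?_,
      fun i hi => if_pos hi, fun i hi => if_neg (by omega)⟩
    intro i hi
    by_contra hc
    exact hi (if_neg (by simp at hc; omega))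
  have hsplit := apply_eq_components δ hcomp0 hcomp
  refine ⟨⟨?_, ?_⟩, ⟨?_, ?_⟩⟩
  · rintro ⟨A, hA, hd⟩
    have hsupp : ∀ i, A i ≠ 0 → i ∈ Finset.range (k + 1) := fun i hi => by
      by_contra hc
      exact hi (hA i (by simp at hc; omega))
    let B : ℕ →₀ C0 × Cp := Finsupp.onFinset _ A hsupp
    let x : ℕ →₀ Cp := B.mapRange Prod.snd rfl
    let y : ℕ →₀ C0 := B.mapRange Prod.fst rfl
    have hx : ∀ i, k + 1 ≤ i → x i = 0 := fun i hi => by simp [x, B, hA i hi]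
    have hd' : ∀ j, (deltaZero δ 0 (y j) + dS1 (deltaPlusZero δ) x j, dS1 (deltaPlus δ) x j) =
        if j = 0 then ((e, 0) : C0 × Cp) else 0 := fun j => by
      have hy := sum_deltaZero δ hcomp k fun i => y (j + i)
      rw [add_zero] at hy
      rw [← hd j, ← hy, dS1_eq_sum_range _ hx (m := k + 1) (by omega),
        dS1_eq_sum_range _ hx (m := k + 1) (by omega), ← Finset.sum_add_distrib]
      ext <;> simp only [Prod.fst_sum, Prod.snd_sum] <;>
        refine Finset.sum_congr rfl fun i _ => ?_
      · exact (congrArg Prod.fst (hsplit i (A (j + i)).1 (A (j + i)).2)).symm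
      · exact (congrArg Prod.snd (hsplit i (A (j + i)).1 (A (j + i)).2)).symm
    refine ⟨x, fun j => ?_, ⟨-y, fun j => ?_⟩, 0, fun j => ?_⟩
    · have := congrArg Prod.snd (hd' j)
      split_ifs at this <;> simpa using this
    · have := congrArg Prod.fst (hd' j)
      rw [Finsupp.neg_apply, map_neg, eq_sub_iff_add_eq]
      rw [apply_ite Prod.fst, Prod.fst_zero] at this
      rw [← this, neg_add_cancel_left]
    · rw [hx _ (by omega)]; simp [dS1]
  · rintro ⟨x, hx, ⟨y, hy⟩, z, hz⟩
    obtain ⟨x', w, hx'k, hx', hf⟩ := hδ.exists_truncated_cycle hcomp0 hcomp hx hz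
    let a : ℕ → C0 := fun j =>
      if j ≤ k then -(y j + dS1 (deltaPlusZero δ) w j) else 0
    refine ⟨fun j => (a j, x' j), fun j hj => ?_, fun j => ?_⟩
    · simp [a, hx'k j hj, Nat.not_le.mpr hj]
    · have ha := sum_deltaZero δ hcomp k fun i => a (j + i)
      have h1 := hx' j
      have h2 := hf j
      have hy := hy j
      rw [dS1_eq_sum_range _ hx'k (m := k + 1) (by omega)] at h1
      simp only [hsplit]
      ext
      · rw [Prod.fst_sum, Finset.sum_add_distrib, ha]
        by_cases hj : j ≤ k
        · rw [← dS1_eq_sum_range _ hx'k (m := k + 1) (by omega), h2]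
          simp only [a, add_zero, if_pos hj, map_neg, map_add, hy]
          split_ifs <;> simp <;> abel
        · rw [Finset.sum_eq_zero fun i _ => by rw [hx'k _ (by omega), map_zero]]
          simp [a, hj, show j ≠ 0 by omega]
      · rw [Prod.snd_sum, h1]
        split_ifs <;> rfl
  · rintro ⟨α, hα, hp⟩
    obtain ⟨x, hxα, hx⟩ := hbound fun i => α (k - i)
    refine ⟨x, fun j => ?_, ?_, 0, fun j => ?_⟩
    · rcases Nat.lt_or_ge k j with hj | hj
      · rw [dS1_eq_sum_range _ hx (m := 0) (by omega)]; simp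
      · rw [dS1_eq_sum_range _ hx (m := k - j + 1) (by omega), ← hα (k - j) (by omega)]
        refine Finset.sum_congr rfl fun i hi => ?_
        rw [hxα _ (by simp at hi; omega), Nat.sub_sub]
    · rw [dS1_eq_sum_range _ hx (m := k + 1) (by omega), ← hp]
      congr 1
      refine Finset.sum_congr rfl fun i hi => ?_
      rw [hxα _ (by simp at hi; omega), zero_add]
    · rw [hx _ (by omega)]; simp [dS1]
  · rintro ⟨x, hx, hp, z, hz⟩
    obtain ⟨x', w, hx'k, hx', hf⟩ := hδ.exists_truncated_cycle hcomp0 hcomp hx hz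
    refine ⟨fun i => x' (k - i), fun m hm => ?_, ?_⟩
    · rw [← hx' (k - m), dS1_eq_sum_range _ hx'k (m := m + 1) (by omega)]
      refine Finset.sum_congr rfl fun i hi => ?_
      dsimp only
      rw [show k - (m - i) = k - m + i by simp at hi; omega]
    · have h := congrArg p (hf 0)
      rw [map_add, hp, show p (deltaZero δ 0 _) = 0 from hp0 _, add_zero,
        dS1_eq_sum_range _ hx'k (m := k + 1) (by omega)] at h
      rw [← h]
      congr 1
      refine Finset.sum_congr rfl fun i hi => ?_
      dsimp only
      rw [show k - (k - i) = 0 + i by simp at hi; omega]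
end

section
/- Let n ≥ 4 be an integer and define the sequence a₀, …, a_n by aᵢ := i + 2 for 0 ≤ i ≤ n − 2 and a_{n−1} := a_n := n. Let f be the associated minimal Conley–Zehnder index function. Then f(4) = n − 1, and f(T) ≥ n − 1 for every integer T ≥ 4. -/
/-!
STATEMENT 14: Let n ≥ 4 be an integer and define the sequence a₀, …, a_n by
aᵢ := i + 2 for 0 ≤ i ≤ n − 2 and a_{n−1} := a_n := n.  Let f be the associated
minimal Conley–Zehnder index function.  Then f(4) = n − 1, and f(T) ≥ n − 1 for every
integer T ≥ 4.
-/

open Finset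

/-- `I_T := {i ∈ {0, …, n} : aᵢ ∣ T}`. -/
def brieskornI (n : ℕ) (a : Fin (n + 1) → ℕ) (T : ℕ) : Finset (Fin (n + 1)) :=
  Finset.univ.filter fun i => a i ∣ T

/-- `f(T) := 2∑_{i=0}^{n} ⌊T/aᵢ⌋ + n + 3 − 2|I_T| − 2T ∈ ℤ`, the minimal
Conley–Zehnder index formula for Brieskorn manifolds. -/
def brieskornF (n : ℕ) (a : Fin (n + 1) → ℕ) (T : ℕ) : ℤ :=
  2 * (∑ i : Fin (n + 1), ((T / a i : ℕ) : ℤ)) + (n : ℤ) + 3 -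
    2 * ((brieskornI n a T).card : ℤ) - 2 * (T : ℤ)

/-- Subtracting the divisibility count from the sum of `⌊T/aᵢ⌋` replaces `T` by `T - 1`. -/
theorem brieskornF_succ (n : ℕ) (a : Fin (n + 1) → ℕ) (m : ℕ) :
    brieskornF n a (m + 1) =
      2 * ((∑ i : Fin (n + 1), m / a i : ℕ) : ℤ) + (n : ℤ) + 1 - 2 * (m : ℤ) := by
  have h : ∑ i : Fin (n + 1), (m + 1) / a i =
      (∑ i : Fin (n + 1), m / a i) + (brieskornI n a (m + 1)).card := by
    simp only [Nat.succ_div, brieskornI, Finset.card_filter, Finset.sum_add_distrib]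
  unfold brieskornF
  rw [← Nat.cast_sum, h]
  push_cast
  ring

theorem stmt_14 (n : ℕ) (hn : 4 ≤ n)
    (a : Fin (n + 1) → ℕ)
    (ha : ∀ i : Fin (n + 1), a i = if (i : ℕ) ≤ n - 2 then (i : ℕ) + 2 else n) :
    brieskornF n a 4 = (n : ℤ) - 1 ∧
    ∀ T : ℕ, 4 ≤ T → (n : ℤ) - 1 ≤ brieskornF n a T := by
  obtain ⟨k, rfl⟩ := Nat.exists_eq_add_of_le' hn
  have split (m : ℕ) : ∑ i, m / a i =
      m / 2 + (m / 3 + (m / 4 + ∑ i : Fin (k + 2), m / a i.succ.succ.succ)) := by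
    have h0 : a 0 = 2 := by simp [ha]
    have h1 : a (Fin.succ 0) = 3 := by rw [ha]; simp
    have h2 : a (Fin.succ (Fin.succ 0)) = 4 := by
      rw [ha, if_pos] <;> simp only [Fin.val_succ, Fin.val_zero]
      omega
    rw [Fin.sum_univ_succ, Fin.sum_univ_succ, Fin.sum_univ_succ, h0, h1, h2]
  constructor
  · have tail : ∑ i : Fin (k + 2), 3 / a i.succ.succ.succ = 0 := by
      refine Finset.sum_eq_zero fun i _ => Nat.div_eq_of_lt ?_
      rw [ha]
      simp only [Fin.val_succ]
      split_ifs <;> omega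
    rw [brieskornF_succ, split, tail]
    push_cast
    omega
  · intro T hT
    obtain ⟨m, rfl⟩ : ∃ m, T = m + 1 := ⟨T - 1, by omega⟩
    rw [brieskornF_succ, split]
    omega
end
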